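/- Let F be a field of characteristic ≠ 2, and let m_1, ..., m_k be positive integers with ℓ of them odd and k - ℓ even; set N_{k,ℓ} = Σ m_i - 2k + ℓ + 2 and r = N_{k,ℓ} - 2. Then the algebra A = E ⊗ E_r (tensor product over F of the infinite Grassmann algebra with the r-generated Grassmann algebra) satisfies: (i) A is Lie nilpotent of class at most N_{k,ℓ}, i.e., T^(1+N_{k,ℓ})(A) = 0; and (ii) there exist elements v_{ij} ∈ A with [v_{11}, ..., v_{1 m_1}]···[v_{k1}, ..., v_{k m_k}] ≠ 0. -/

import Mathlib

open scoped TensorProduct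

/-- Left-normed commutator: `lc a [b₁,...,bₙ] = [a, b₁, ..., bₙ]`. -/
def lc {A : Type*} [Ring A] : A → List A → A
  | a, [] => a
  | a, b :: l => lc ⁅a, b⁆ l

/-- Left-normed commutator of a list; `lcomm [a₁,...,aₙ] = [a₁,...,aₙ]`, `lcomm [] = 0`. -/
def lcomm {A : Type*} [Ring A] : List A → A
  | [] => 0
  | a :: l => lc a l

/-- `Tideal A n` = two-sided ideal of `A` generated by all left-normed commutators of length `n`. -/
def Tideal (A : Type*) [Ring A] (n : ℕ) : TwoSidedIdeal A :=
  TwoSidedIdeal.span {x | ∃ l : List A, l.length = n ∧ x = lcomm l}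

/-- The infinite-dimensional Grassmann (exterior) algebra over `F`, on a vector space with
basis `e₁, e₂, …` indexed by `ℕ`. -/
abbrev GrassmannAlg (F : Type*) [Field F] := ExteriorAlgebra F (ℕ →₀ F)

/-- The generators `eᵢ` of the Grassmann algebra. -/
noncomputable def grassGen (F : Type*) [Field F] (i : ℕ) : GrassmannAlg F :=
  ExteriorAlgebra.ι F (Finsupp.single i (1 : F))

set_option synthInstance.maxHeartbeats 1000000
set_option maxHeartbeats 1000000

/-- The `r`-generated unital Grassmann subalgebra `E_r`, generated by `e₁, …, e_r`. -/
noncomputable def GrassmannSub (F : Type*) [Field F] (r : ℕ) : Subalgebra F (GrassmannAlg F) :=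
  Algebra.adjoin F (grassGen F '' {i | 1 ≤ i ∧ i ≤ r})

theorem lc_append_singleton {A : Type*} [Ring A] (a b : A) (l : List A) :
    lc a (l ++ [b]) = ⁅lc a l, b⁆ := by
  induction l generalizing a with
  | nil => rfl
  | cons x l ih => exact ih ⁅a, x⁆

theorem ring_smul_lie {F A : Type*} [CommRing F] [Ring A] [Algebra F A] (c : F) (a b : A) :
    ⁅c • a, b⁆ = c • ⁅a, b⁆ := by
  simp [Ring.lie_def, smul_sub]

theorem ring_lie_smul {F A : Type*} [CommRing F] [Ring A] [Algebra F A] (c : F) (a b : A) :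
    ⁅a, c • b⁆ = c • ⁅a, b⁆ := by
  simp [Ring.lie_def, smul_sub]

theorem lc_smul {F A : Type*} [CommRing F] [Ring A] [Algebra F A] (c : F) (a : A) (l : List A) :
    lc (c • a) l = c • lc a l := by
  induction l generalizing a with
  | nil => rfl
  | cons x l ih => simp only [lc, ring_smul_lie, ih]

section Anticommuting

variable {F B C : Type*} [Field F] [Ring B] [Algebra F B] [Ring C] [Algebra F C]

/-- Products of pairwise anticommuting elements commute up to the Koszul sign. -/
theorem prod_map_mul_prod_map {ι : Type*} {f : ι → B} (hf : ∀ i j, f i * f j = -(f j * f i))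
    (l l' : List ι) :
    (l'.map f).prod * (l.map f).prod =
      (-1 : F) ^ (l.length * l'.length) • ((l.map f).prod * (l'.map f).prod) := by
  have single (i : ι) (l : List ι) :
      (l.map f).prod * f i = (-1 : F) ^ l.length • (f i * (l.map f).prod) := by
    induction l with
    | nil => simp
    | cons x l ih =>
      rw [List.map_cons, List.prod_cons, mul_assoc, ih, mul_smul_comm, ← mul_assoc, hf x i,
        List.length_cons, pow_succ, mul_smul, neg_mul, neg_one_smul, mul_assoc]
  induction l with
  | nil => simp
  | cons x l ih =>
    rw [List.map_cons, List.prod_cons, ← mul_assoc, single, smul_mul_assoc, mul_assoc, ih,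
      mul_smul_comm, smul_smul, ← pow_add, mul_assoc, List.length_cons]
    congr 2
    ring

theorem prod_map_eq_zero_of_not_nodup {ι : Type*} {f : ι → B}
    (hf : ∀ i j, f i * f j = -(f j * f i)) (hsq : ∀ i, f i * f i = 0)
    {l : List ι} (hl : ¬ l.Nodup) : (l.map f).prod = 0 := by
  induction l with
  | nil => simp at hl
  | cons x l ih =>
    by_cases hx : x ∈ l
    · obtain ⟨s, t, rfl⟩ := List.append_of_mem hx
      have h : f x * (s.map f).prod = (-1 : ℤ) ^ s.length • ((s.map f).prod * f x) := by
        clear ih hl hx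
        induction s with
        | nil => simp
        | cons y s ih =>
          rw [List.map_cons, List.prod_cons, ← mul_assoc, hf x y, neg_mul, mul_assoc, ih,
            mul_smul_comm, List.length_cons, pow_succ, mul_smul, neg_one_smul, smul_neg, mul_assoc]
      simp only [List.map_cons, List.map_append, List.prod_cons, List.prod_append]
      rw [← mul_assoc, h, smul_mul_assoc, mul_assoc, ← mul_assoc (f x) (f x), hsq]
      simp
    · rw [List.map_cons, List.prod_cons, ih (fun h => hl (List.nodup_cons.2 ⟨hx, h⟩)), mul_zero]

/-- The pure tensor of a word in `f` and a word in `g`. -/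
def tensorWord (F : Type*) {B C : Type*} [Field F] [Ring B] [Algebra F B] [Ring C] [Algebra F C]
    {ι κ : Type*} (f : ι → B) (g : κ → C) (l : List ι) (l' : List κ) : B ⊗[F] C :=
  (l.map f).prod ⊗ₜ[F] (l'.map g).prod

variable {ι κ : Type*} {f : ι → B} {g : κ → C}

theorem tensorWord_mul (p p' : List ι) (q q' : List κ) :
    tensorWord F f g p q * tensorWord F f g p' q' = tensorWord F f g (p ++ p') (q ++ q') := by
  simp [tensorWord]

theorem lie_tensorWord (hf : ∀ i j, f i * f j = -(f j * f i))
    (hg : ∀ i j, g i * g j = -(g j * g i)) (p p' : List ι) (q q' : List κ) :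
    ⁅tensorWord F f g p q, tensorWord F f g p' q'⁆ =
      (1 - (-1 : F) ^ (p.length * p'.length + q.length * q'.length)) •
        tensorWord F f g (p ++ p') (q ++ q') := by
  rw [Ring.lie_def, sub_smul, one_smul, tensorWord_mul]
  congr 1
  simp only [tensorWord, Algebra.TensorProduct.tmul_mul_tmul, List.map_append, List.prod_append]
  rw [prod_map_mul_prod_map (F := F) hf, prod_map_mul_prod_map (F := F) hg,
    TensorProduct.smul_tmul_smul, pow_add]

theorem lie_tensorWord_of_even (hf : ∀ i j, f i * f j = -(f j * f i))
    (hg : ∀ i j, g i * g j = -(g j * g i)) {p p' : List ι} {q q' : List κ}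
    (h : Even (p.length * p'.length + q.length * q'.length)) :
    ⁅tensorWord F f g p q, tensorWord F f g p' q'⁆ = 0 := by
  rw [lie_tensorWord hf hg, h.neg_one_pow, sub_self, zero_smul]

theorem lie_tensorWord_of_odd (hf : ∀ i j, f i * f j = -(f j * f i))
    (hg : ∀ i j, g i * g j = -(g j * g i)) {p p' : List ι} {q q' : List κ}
    (h : Odd (p.length * p'.length + q.length * q'.length)) :
    ⁅tensorWord F f g p q, tensorWord F f g p' q'⁆ =
      (2 : F) • tensorWord F f g (p ++ p') (q ++ q') := by
  rw [lie_tensorWord hf hg, h.neg_one_pow, sub_neg_eq_add, one_add_one_eq_two]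

theorem span_range_prod_map (h : Algebra.adjoin F (Set.range f) = ⊤) :
    Submodule.span F (Set.range fun l : List ι => (l.map f).prod) = ⊤ := by
  rw [eq_top_iff, ← Algebra.top_toSubmodule, ← h, Algebra.adjoin_eq_span]
  refine Submodule.span_mono fun x hx => ?_
  obtain ⟨l, hl, rfl⟩ := Submonoid.exists_list_of_mem_closure hx
  obtain ⟨w, rfl⟩ := (Set.range_list_map f).ge hl
  exact ⟨w, rfl⟩

theorem mem_span_tensorWord (hf : Algebra.adjoin F (Set.range f) = ⊤)
    (hg : Algebra.adjoin F (Set.range g) = ⊤) (x : B ⊗[F] C) :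
    x ∈ Submodule.span F (Set.range fun w : List ι × List κ => tensorWord F f g w.1 w.2) := by
  have h := TensorProduct.map₂_mk_top_top_eq_top F B C
  rw [← span_range_prod_map hf, ← span_range_prod_map hg, Submodule.map₂_span_span] at h
  refine Submodule.span_mono ?_ (h ▸ Submodule.mem_top : x ∈ _)
  rintro _ ⟨_, ⟨p, rfl⟩, _, ⟨q, rfl⟩, rfl⟩
  exact ⟨(p, q), rfl⟩

/-- The span of the words whose pair of lengths can occur in a left-normed commutator of
length `n ≥ 2`. -/
def commutatorSpan (F : Type*) {B C : Type*} [Field F] [Ring B] [Algebra F B] [Ring C]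
    [Algebra F C] {ι κ : Type*} (f : ι → B) (g : κ → C) (n : ℕ) : Submodule F (B ⊗[F] C) :=
  Submodule.span F {x | ∃ p q, x = tensorWord F f g p q ∧ ¬ (Odd p.length ∧ Odd q.length) ∧
    n ≤ q.length + 2 ∧ (Odd (p.length + q.length) → n ≤ q.length + 1)}

theorem lie_mem_of_mem_span {A : Type*} [Ring A] [Algebra F A] {s t : Set A} {M : Submodule F A}
    (h : ∀ x ∈ s, ∀ y ∈ t, ⁅x, y⁆ ∈ M) {a b : A} (ha : a ∈ Submodule.span F s)
    (hb : b ∈ Submodule.span F t) : ⁅a, b⁆ ∈ M := by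
  induction ha, hb using Submodule.span_induction₂ with
  | mem_mem x y hx hy => exact h x hx y hy
  | zero_left | zero_right => simp [Ring.lie_def]
  | add_left x y z _ _ _ h₁ h₂ =>
    have h : ⁅x + y, z⁆ = ⁅x, z⁆ + ⁅y, z⁆ := by simp only [Ring.lie_def]; noncomm_ring
    exact h ▸ M.add_mem h₁ h₂
  | add_right x y z _ _ _ h₁ h₂ =>
    have h : ⁅x, y + z⁆ = ⁅x, y⁆ + ⁅x, z⁆ := by simp only [Ring.lie_def]; noncomm_ring
    exact h ▸ M.add_mem h₁ h₂
  | smul_left c x y _ _ h => exact ring_smul_lie c x y ▸ M.smul_mem c h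
  | smul_right c x y _ _ h => exact ring_lie_smul c x y ▸ M.smul_mem c h

theorem lie_mem_commutatorSpan_two (hf : ∀ i j, f i * f j = -(f j * f i))
    (hg : ∀ i j, g i * g j = -(g j * g i)) (hf' : Algebra.adjoin F (Set.range f) = ⊤)
    (hg' : Algebra.adjoin F (Set.range g) = ⊤) (a b : B ⊗[F] C) :
    ⁅a, b⁆ ∈ commutatorSpan F f g 2 := by
  refine lie_mem_of_mem_span ?_ (mem_span_tensorWord hf' hg' a) (mem_span_tensorWord hf' hg' b)
  rintro _ ⟨⟨p, q⟩, rfl⟩ _ ⟨⟨p', q'⟩, rfl⟩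
  rcases Nat.even_or_odd (p.length * p'.length + q.length * q'.length) with h | h
  · exact lie_tensorWord_of_even (F := F) hf hg h ▸ Submodule.zero_mem _
  · rw [lie_tensorWord_of_odd hf hg h]
    refine Submodule.smul_mem _ _ (Submodule.subset_span ⟨_, _, rfl, ?_, by omega, ?_⟩)
    all_goals
      simp only [List.length_append]
      grind [Nat.odd_add, Nat.odd_mul, Nat.not_even_iff_odd, Odd.pos]

theorem lie_mem_commutatorSpan_succ (hf : ∀ i j, f i * f j = -(f j * f i))
    (hg : ∀ i j, g i * g j = -(g j * g i)) (hf' : Algebra.adjoin F (Set.range f) = ⊤)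
    (hg' : Algebra.adjoin F (Set.range g) = ⊤) {n : ℕ} {a : B ⊗[F] C}
    (ha : a ∈ commutatorSpan F f g n) (b : B ⊗[F] C) :
    ⁅a, b⁆ ∈ commutatorSpan F f g (n + 1) := by
  refine lie_mem_of_mem_span ?_ ha (mem_span_tensorWord hf' hg' b)
  rintro _ ⟨p, q, rfl, h₁, h₂, h₃⟩ _ ⟨⟨p', q'⟩, rfl⟩
  rcases Nat.even_or_odd (p.length * p'.length + q.length * q'.length) with h | h
  · exact lie_tensorWord_of_even (F := F) hf hg h ▸ Submodule.zero_mem _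
  · rw [lie_tensorWord_of_odd hf hg h]
    have hq := fun h : Odd q'.length => h.pos
    refine Submodule.smul_mem _ _ (Submodule.subset_span ⟨_, _, rfl, ?_, ?_, ?_⟩)
    all_goals
      simp only [List.length_append]
      simp only [Nat.odd_add, Nat.odd_mul, ← Nat.not_odd_iff_even] at *
      by_cases Odd p.length <;> by_cases Odd q.length <;> by_cases Odd p'.length <;>
        by_cases Odd q'.length <;> simp_all <;> omega

theorem lc_mem_commutatorSpan (hf : ∀ i j, f i * f j = -(f j * f i))
    (hg : ∀ i j, g i * g j = -(g j * g i)) (hf' : Algebra.adjoin F (Set.range f) = ⊤)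
    (hg' : Algebra.adjoin F (Set.range g) = ⊤) {n : ℕ} {a : B ⊗[F] C}
    (ha : a ∈ commutatorSpan F f g n) (l : List (B ⊗[F] C)) :
    lc a l ∈ commutatorSpan F f g (n + l.length) := by
  induction l generalizing a n with
  | nil => exact ha
  | cons b l ih =>
    have := ih (lie_mem_commutatorSpan_succ hf hg hf' hg' ha b)
    rwa [List.length_cons, add_comm l.length, ← add_assoc]

theorem commutatorSpan_eq_bot {r : ℕ} (hr : ∀ l : List κ, r < l.length → (l.map g).prod = 0) :
    commutatorSpan F f g (r + 3) = ⊥ := by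
  rw [commutatorSpan, Submodule.span_eq_bot]
  rintro _ ⟨p, q, rfl, -, hq, -⟩
  rw [tensorWord, hr q (by omega), TensorProduct.tmul_zero]

theorem lcomm_eq_zero (hf : ∀ i j, f i * f j = -(f j * f i))
    (hg : ∀ i j, g i * g j = -(g j * g i)) (hf' : Algebra.adjoin F (Set.range f) = ⊤)
    (hg' : Algebra.adjoin F (Set.range g) = ⊤) {r : ℕ}
    (hr : ∀ l : List κ, r < l.length → (l.map g).prod = 0) {l : List (B ⊗[F] C)}
    (hl : l.length = r + 3) : lcomm l = 0 := by
  match l, hl with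
  | a :: b :: l, hl =>
    have h := lc_mem_commutatorSpan hf hg hf' hg'
      (lie_mem_commutatorSpan_two hf hg hf' hg' a b) l
    have hlen : 2 + l.length = r + 3 := by simp at hl; omega
    rwa [hlen, commutatorSpan_eq_bot hr, Submodule.mem_bot] at h

end Anticommuting

section Nonvanishing

variable {F B C : Type*} [Field F] [Ring B] [Algebra F B] [Ring C] [Algebra F C]
  {f : ℕ → B} {g : ℕ → C}

theorem exists_lc_eq_smul_tensorWord (h2 : (2 : F) ≠ 0) (hf : ∀ i j, f i * f j = -(f j * f i))
    (hg : ∀ i j, g i * g j = -(g j * g i)) (n a b : ℕ) (p q : List ℕ)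
    (hpq : Odd (p.length + q.length)) :
    ∃ l : List (B ⊗[F] C), l.length = n ∧ ∃ c : F, c ≠ 0 ∧
      lc (tensorWord F f g p q) l =
        c • tensorWord F f g (p ++ List.range' a n) (q ++ List.range' b n) := by
  induction n generalizing a b p q with
  | zero => exact ⟨[], rfl, 1, one_ne_zero, by simp [lc]⟩
  | succ n ih =>
    obtain ⟨l, hl, c, hc, h⟩ := ih (a + 1) (b + 1) (p ++ [a]) (q ++ [b])
      (by simp only [List.length_append, List.length_singleton]; grind)
    refine ⟨tensorWord F f g [a] [b] :: l, by simp [hl], 2 * c, mul_ne_zero h2 hc, ?_⟩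
    rw [lc, lie_tensorWord_of_odd hf hg (by simpa using hpq), lc_smul, h, smul_smul]
    simp [List.range'_succ]

/-- The least number of letters from the second factor needed in a nonzero commutator of
length `n`. -/
def minSecondDegree (n : ℕ) : ℕ := if Even n then n - 2 else n - 1

theorem exists_lcomm_eq_smul_tensorWord (h2 : (2 : F) ≠ 0)
    (hf : ∀ i j, f i * f j = -(f j * f i)) (hg : ∀ i j, g i * g j = -(g j * g i))
    {n : ℕ} (hn : 0 < n) (a b : ℕ) :
    ∃ v : Fin n → B ⊗[F] C, ∃ c : F, c ≠ 0 ∧ lcomm (List.ofFn v) =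
      c • tensorWord F f g (List.range' a n) (List.range' b (minSecondDegree n)) := by
  suffices ∃ l : List (B ⊗[F] C), l.length = n ∧ ∃ c : F, c ≠ 0 ∧ lcomm l =
      c • tensorWord F f g (List.range' a n) (List.range' b (minSecondDegree n)) by
    obtain ⟨l, rfl, h⟩ := this
    exact ⟨l.get, by simpa using h⟩
  rcases Nat.even_or_odd n with hn' | hn'
  · obtain ⟨t, rfl⟩ : ∃ t, n = 2 * t + 2 := ⟨n / 2 - 1, by grind⟩
    obtain ⟨l, hl, c, hc, h⟩ := exists_lc_eq_smul_tensorWord h2 hf hg (2 * t) (a + 1) b [a] []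
      (by simp)
    refine ⟨tensorWord F f g [a] [] :: (l ++ [tensorWord F f g [a + (2 * t + 1)] []]),
      by simp [hl], c * 2, mul_ne_zero hc h2, ?_⟩
    rw [lcomm, lc_append_singleton, h, ring_smul_lie, lie_tensorWord_of_odd hf hg (by simp),
      smul_smul, minSecondDegree, if_pos hn', Nat.add_sub_cancel]
    have : List.range' a (2 * t + 2) = [a] ++ List.range' (a + 1) (2 * t) ++ [a + (2 * t + 1)] := by
      rw [List.range'_concat, List.range'_succ]; simp
    rw [this]
    simp
  · obtain ⟨t, rfl⟩ := hn'
    obtain ⟨l, hl, c, hc, h⟩ := exists_lc_eq_smul_tensorWord h2 hf hg (2 * t) (a + 1) b [a] []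
      (by simp)
    refine ⟨tensorWord F f g [a] [] :: l, by simp [hl], c, hc, ?_⟩
    rw [lcomm, h, minSecondDegree, if_neg (by simp), List.range'_succ]
    simp

theorem exists_prod_lcomm_eq_smul_tensorWord (h2 : (2 : F) ≠ 0)
    (hf : ∀ i j, f i * f j = -(f j * f i)) (hg : ∀ i j, g i * g j = -(g j * g i))
    {k : ℕ} (m : Fin k → ℕ) (hm : ∀ i, 0 < m i) (a b : ℕ) :
    ∃ v : (i : Fin k) → Fin (m i) → B ⊗[F] C, ∃ c : F, c ≠ 0 ∧
      (List.ofFn fun i => lcomm (List.ofFn (v i))).prod =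
        c • tensorWord F f g (List.range' a (∑ i, m i))
          (List.range' b (∑ i, minSecondDegree (m i))) := by
  induction k generalizing a b with
  | zero =>
    exact ⟨fun i => i.elim0, 1, one_ne_zero, by simp [tensorWord, Algebra.TensorProduct.one_def]⟩
  | succ k ih =>
    obtain ⟨v₀, c₀, hc₀, h₀⟩ := exists_lcomm_eq_smul_tensorWord h2 hf hg (hm 0) a b
    obtain ⟨v, c, hc, h⟩ := ih (fun i => m i.succ) (fun i => hm i.succ) (a + m 0)
      (b + minSecondDegree (m 0))
    refine ⟨Fin.cons v₀ v, c₀ * c, mul_ne_zero hc₀ hc, ?_⟩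
    simp only [List.ofFn_succ, List.prod_cons, Fin.cons_zero, Fin.cons_succ] at h ⊢
    rw [h₀, h, smul_mul_smul_comm, tensorWord_mul, Fin.sum_univ_succ, Fin.sum_univ_succ,
      List.range'_append_1, List.range'_append_1]

end Nonvanishing

section Grassmann

variable (F : Type*) [Field F]

theorem grassGen_mul_grassGen (i j : ℕ) :
    grassGen F i * grassGen F j = -(grassGen F j * grassGen F i) :=
  eq_neg_of_add_eq_zero_left (ExteriorAlgebra.ι_add_mul_swap (R := F) _ _)

theorem adjoin_range_grassGen : Algebra.adjoin F (Set.range (grassGen F)) = ⊤ := by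
  have hι : Set.range (ExteriorAlgebra.ι F (M := ℕ →₀ F)) ⊆
      Algebra.adjoin F (Set.range (grassGen F)) := by
    rintro _ ⟨v, rfl⟩
    induction v using Finsupp.induction_linear with
    | zero => simp
    | add v w hv hw => rw [map_add]; exact add_mem hv hw
    | single i c =>
      rw [← mul_one c, ← smul_eq_mul, ← Finsupp.smul_single, map_smul]
      exact Subalgebra.smul_mem _ (Algebra.subset_adjoin (Set.mem_range_self i)) c
  rw [eq_top_iff, ← CliffordAlgebra.adjoin_range_ι]
  exact Algebra.adjoin_le hι

theorem prod_map_grassGen_ne_zero {l : List ℕ} (hl : l.Nodup) :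
    (l.map (grassGen F)).prod ≠ 0 := by
  let φ : (ℕ →₀ F) →ₗ[F] Fin l.length → F := LinearMap.pi fun i => Finsupp.lapply (l.get i)
  let D : (ℕ →₀ F) [⋀^Fin l.length]→ₗ[F] F := Matrix.detRowAlternating.compLinearMap φ
  let v : Fin l.length → ℕ →₀ F := fun i => Finsupp.single (l.get i) 1
  have hv : ExteriorAlgebra.ιMulti F l.length v = (l.map (grassGen F)).prod := by
    rw [ExteriorAlgebra.ιMulti_apply]
    conv_rhs => rw [← List.ofFn_get l, List.map_ofFn]
    rfl
  have hD : D v = 1 := by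
    have : (fun i => φ (v i)) = (1 : Matrix (Fin l.length) (Fin l.length) F) := by
      ext i j
      simp only [φ, v, LinearMap.pi_apply, Finsupp.lapply_apply, Finsupp.single_apply,
        Matrix.one_apply, hl.get_inj_iff]
    change Matrix.det (fun i => φ (v i)) = 1
    rw [this, Matrix.det_one]
  intro h
  have := ExteriorAlgebra.liftAlternating_apply_ιMulti (R := F) (Pi.single l.length D) v
  rw [hv, h, map_zero, Pi.single_eq_same, hD] at this
  exact zero_ne_one this

/-- The `i`-th generator of `E_r`, extended by zero outside `1 ≤ i ≤ r`. -/
noncomputable def subGen (r i : ℕ) : GrassmannSub F r :=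
  if h : 1 ≤ i ∧ i ≤ r then ⟨grassGen F i, Algebra.subset_adjoin ⟨i, h, rfl⟩⟩ else 0

variable {F}

theorem coe_subGen {r i : ℕ} (h : 1 ≤ i ∧ i ≤ r) :
    (subGen F r i : GrassmannAlg F) = grassGen F i := by
  rw [subGen, dif_pos h]

theorem subGen_mul_subGen (r i j : ℕ) :
    subGen F r i * subGen F r j = -(subGen F r j * subGen F r i) := by
  by_cases hi : 1 ≤ i ∧ i ≤ r
  · by_cases hj : 1 ≤ j ∧ j ≤ r
    · ext
      simpa [coe_subGen hi, coe_subGen hj] using grassGen_mul_grassGen F i j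
    · simp [subGen, hj]
  · simp [subGen, hi]

theorem subGen_mul_self (r i : ℕ) : subGen F r i * subGen F r i = 0 := by
  by_cases hi : 1 ≤ i ∧ i ≤ r
  · ext
    simp [coe_subGen hi, grassGen]
  · simp [subGen, hi]

theorem adjoin_range_subGen (r : ℕ) : Algebra.adjoin F (Set.range (subGen F r)) = ⊤ := by
  refine eq_top_iff.2 ((Algebra.adjoin_adjoin_coe_preimage (R := F)
    (s := grassGen F '' {i | 1 ≤ i ∧ i ≤ r})).ge.trans (Algebra.adjoin_mono ?_))
  rintro x ⟨i, hi, hx⟩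
  exact ⟨i, Subtype.ext ((coe_subGen hi).trans hx)⟩

theorem prod_map_subGen_eq_zero {r : ℕ} {l : List ℕ} (hl : r < l.length) :
    (l.map (subGen F r)).prod = 0 := by
  by_cases hnd : l.Nodup
  · by_cases h : ∀ i ∈ l, 1 ≤ i ∧ i ≤ r
    · have := Finset.card_le_card (s := l.toFinset) (t := Finset.Icc 1 r)
        fun i hi => Finset.mem_Icc.2 (h i (List.mem_toFinset.1 hi))
      rw [List.toFinset_card_of_nodup hnd, Nat.card_Icc] at this
      omega
    · push Not at h
      obtain ⟨i, hi, hi'⟩ := h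
      exact List.prod_eq_zero (List.mem_map.2 ⟨i, hi, by rw [subGen, dif_neg]; grind⟩)
  · exact prod_map_eq_zero_of_not_nodup (subGen_mul_subGen r) (subGen_mul_self r) hnd

theorem prod_map_subGen_ne_zero (r : ℕ) : ((List.range' 1 r).map (subGen F r)).prod ≠ 0 := by
  intro h
  have h' := congrArg (GrassmannSub F r).val h
  rw [map_list_prod, List.map_map, map_zero] at h'
  refine prod_map_grassGen_ne_zero F (List.nodup_range' (s := 1) (n := r)) ?_
  rw [← h']
  congr 1
  refine List.map_congr_left fun i hi => (coe_subGen ?_).symm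
  grind

theorem tmul_ne_zero {V W : Type*} [AddCommGroup V] [Module F V] [AddCommGroup W] [Module F W]
    {v : V} {w : W} (hv : v ≠ 0) (hw : w ≠ 0) : v ⊗ₜ[F] w ≠ 0 := by
  obtain ⟨φ, hφ⟩ := not_forall.1 (mt (Module.forall_dual_apply_eq_zero_iff F v).1 hv)
  obtain ⟨ψ, hψ⟩ := not_forall.1 (mt (Module.forall_dual_apply_eq_zero_iff F w).1 hw)
  intro h
  have := congrArg (LinearMap.mul' F F ∘ₗ TensorProduct.map φ ψ) h
  exact mul_ne_zero hφ hψ (by simpa using this)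

theorem tensorWord_ne_zero (n r : ℕ) :
    tensorWord F (grassGen F) (subGen F r) (List.range' 0 n) (List.range' 1 r) ≠ 0 :=
  tmul_ne_zero (prod_map_grassGen_ne_zero F List.nodup_range') (prod_map_subGen_ne_zero r)

end Grassmann

/-- Theorem 7 (char ≠ 2 case): for `A = E ⊗ E_r` with `r = N_{k,ℓ} - 2`,
(i) `A` is Lie nilpotent of class at most `N_{k,ℓ}`, i.e. `T^(1+N_{k,ℓ})(A) = 0`, and
(ii) some product of left-normed commutators of lengths `m₁, …, m_k` is nonzero in `A`. -/
theorem statement_11 (F : Type*) [Field F] (hF : ringChar F ≠ 2)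
    (k ℓ : ℕ) (hk : 0 < k) (hℓk : ℓ ≤ k) (m : Fin k → ℕ) (hpos : ∀ i, 0 < m i)
    (S : Finset (Fin k)) (hcard : S.card = ℓ)
    (hoddS : ∀ i ∈ S, Odd (m i)) (hevenS : ∀ i ∉ S, Even (m i))
    (N r : ℕ) (hN : N = (∑ i, m i) + ℓ + 2 - 2 * k) (hr : r = N - 2) :
    (∀ x ∈ Tideal (GrassmannAlg F ⊗[F] (GrassmannSub F r)) (1 + N), x = 0) ∧
    (∃ v : (i : Fin k) → Fin (m i) → GrassmannAlg F ⊗[F] (GrassmannSub F r),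
      (List.ofFn fun i : Fin k => lcomm (List.ofFn fun j : Fin (m i) => v i j)).prod ≠ 0) := by
  have h2 : (2 : F) ≠ 0 := Ring.two_ne_zero hF
  have hsum : ∑ i, m i + ℓ = ∑ i, minSecondDegree (m i) + 2 * k := by
    have hℓ : ℓ = ∑ i, if i ∈ S then 1 else 0 := by simp [hcard]
    have hk : 2 * k = ∑ _i : Fin k, 2 := by simp [mul_comm]
    rw [hℓ, hk, ← Finset.sum_add_distrib, ← Finset.sum_add_distrib]
    refine Finset.sum_congr rfl fun i _ => ?_
    have := hpos i
    by_cases hi : i ∈ S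
    · rw [if_pos hi, minSecondDegree, if_neg (Nat.not_even_iff_odd.2 (hoddS i hi))]
      omega
    · obtain ⟨t, ht⟩ := hevenS i hi
      rw [if_neg hi, minSecondDegree, if_pos (hevenS i hi)]
      omega
  have hr' : r = ∑ i, minSecondDegree (m i) := by omega
  refine ⟨fun x hx => ?_, ?_⟩
  · have hle : Tideal (GrassmannAlg F ⊗[F] (GrassmannSub F r)) (1 + N) ≤ ⊥ := by
      refine TwoSidedIdeal.span_le.2 ?_
      rintro _ ⟨l, hl, rfl⟩
      exact (TwoSidedIdeal.mem_bot _).2 (lcomm_eq_zero (F := F) (grassGen_mul_grassGen F)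
        (subGen_mul_subGen r) (adjoin_range_grassGen F) (adjoin_range_subGen r)
        (fun _ => prod_map_subGen_eq_zero) (by omega))
    exact (TwoSidedIdeal.mem_bot _).1 (hle hx)
  · obtain ⟨v, c, hc, h⟩ := exists_prod_lcomm_eq_smul_tensorWord h2 (grassGen_mul_grassGen F)
      (subGen_mul_subGen (F := F) r) m hpos 0 1
    refine ⟨v, ?_⟩
    rw [h, ← hr']
    exact smul_ne_zero hc (tensorWord_ne_zero _ r)
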